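/- Let a >= 1 and k >= 1 be integers, set h = (k-1)(2a+k) + 2a - 1, and for p in {1, ..., a+k} define D_p = { p*h + p(p-1) + 2*p*i : i in {1, ..., k+1} } if p <= a, and D_p = { p*h + p(p-1) + 2*p*i : i in {1, ..., (k+1)-(p-a)} } if a < p <= a+k; let D be the union of the sets D_p over p in {1, ..., a+k}. Let T be the starlike tree T(a, a+1, ..., a+k, (2a+k)(k+1)/2) with arms of lengths a, a+1, ..., a+k together with one arm of length (2a+k)(k+1)/2. If no element d of D is a perfect square lying in the interval [k(2a+k-1)+1, ((2a+k)(k+1)/2)^2], then T is transmission irregular. -/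

import Mathlib

/-- The transmission of a vertex `v`: the sum of distances from `v` to all vertices. -/
noncomputable def transmission {V : Type*} [Fintype V] (G : SimpleGraph V) (v : V) : ℕ :=
  ∑ u, G.dist v u

/-- A graph is transmission irregular if all vertices have pairwise distinct transmissions. -/
def TransmissionIrregular {V : Type*} [Fintype V] (G : SimpleGraph V) : Prop :=
  Function.Injective (transmission G)

/-- The starlike tree `T(k 0, …, k (t-1))`: a central vertex (`none`) with `t` pendant
paths attached, the `i`-th of length `k i`; `some ⟨i, j⟩` is the vertex at distance
`j + 1` from the center on the `i`-th arm. -/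
def starlike (t : ℕ) (k : Fin t → ℕ) :
    SimpleGraph (Option (Σ i : Fin t, Fin (k i))) :=
  SimpleGraph.fromRel (fun x y =>
    (∃ i : Fin t, ∃ j : Fin (k i), x = none ∧ y = some ⟨i, j⟩ ∧ (j : ℕ) = 0) ∨
    (∃ i : Fin t, ∃ j j' : Fin (k i), x = some ⟨i, j⟩ ∧ y = some ⟨i, j'⟩ ∧
      (j' : ℕ) = (j : ℕ) + 1))

/-- The set `D_p` with `h = (k-1)(2a+k) + 2a - 1`:
`D_p = {p·h + p(p-1) + 2·p·i : i ∈ [k+1]}` for `p ∈ [a]`, and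
`D_p = {p·h + p(p-1) + 2·p·i : i ∈ [(k+1)-(p-a)]}` for `a < p ≤ a+k`. -/
def Dset (a k : ℕ) (p : ℕ) : Set ℤ :=
  {x : ℤ | ∃ i : ℕ, 1 ≤ i ∧ i ≤ (if p ≤ a then k + 1 else (k + 1) - (p - a)) ∧
    x = (p : ℤ) * (((k : ℤ) - 1) * (2 * (a : ℤ) + (k : ℤ)) + 2 * (a : ℤ) - 1)
        + (p : ℤ) * ((p : ℤ) - 1) + 2 * (p : ℤ) * (i : ℤ)}

/-- A function that vanishes only at `v`, is 1-Lipschitz along edges and decreases by one along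
some edge away from its zero is the distance from `v`. -/
theorem SimpleGraph.dist_eq_of_potential {V : Type*} (G : SimpleGraph V) (v : V) (f : V → ℕ)
    (h0 : ∀ u, f u = 0 ↔ u = v) (hlip : ∀ x y, G.Adj x y → f y ≤ f x + 1)
    (hdesc : ∀ u, f u ≠ 0 → ∃ w, G.Adj w u ∧ f u = f w + 1) (u : V) :
    G.dist v u = f u := by
  have hwalk : ∀ n u, f u = n → ∃ p : G.Walk v u, p.length = n := by
    intro n
    induction n with
    | zero =>
      intro u hu
      obtain rfl := (h0 u).mp hu
      exact ⟨.nil, rfl⟩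
    | succ n ih =>
      intro u hu
      obtain ⟨w, hw, hfw⟩ := hdesc u (by omega)
      obtain ⟨p, hp⟩ := ih w (by omega)
      exact ⟨p.concat hw, by simp [hp]⟩
  have hlower : ∀ x y (p : G.Walk x y), f y ≤ f x + p.length := by
    intro x y p
    induction p with
    | nil => simp
    | cons h p ih =>
      have := hlip _ _ h
      rw [SimpleGraph.Walk.length_cons]
      omega
  obtain ⟨p, hp⟩ := hwalk _ u rfl
  obtain ⟨q, hq⟩ := p.reachable.exists_walk_length_eq_dist
  have h1 := hlower _ _ q
  have h2 := SimpleGraph.dist_le p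
  have h3 := (h0 v).mpr rfl
  omega

/-- The explicit distance function of a starlike tree. -/
def starlikeDist {t : ℕ} {k : Fin t → ℕ} :
    Option (Σ i : Fin t, Fin (k i)) → Option (Σ i : Fin t, Fin (k i)) → ℕ
  | none, none => 0
  | none, some y => y.2 + 1
  | some x, none => x.2 + 1
  | some x, some y =>
    if x.1 = y.1 then ((x.2 : ℕ) - y.2) + ((y.2 : ℕ) - x.2) else (x.2 + 1) + (y.2 + 1)

theorem starlike_adj_none_some {t : ℕ} {k : Fin t → ℕ} (i : Fin t) (j : Fin (k i)) :
    (starlike t k).Adj none (some ⟨i, j⟩) ↔ (j : ℕ) = 0 := by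
  rw [starlike, SimpleGraph.fromRel_adj]
  constructor
  · rintro ⟨-, (⟨i', j', -, h, h0⟩ | ⟨i', j', j'', h, -⟩) | (⟨i', j', h, -⟩ | ⟨i', j', j'', -, h, -⟩)⟩
    · cases h
      exact h0
    all_goals cases h
  · intro h
    exact ⟨by simp, Or.inl (Or.inl ⟨i, j, rfl, rfl, h⟩)⟩

theorem starlike_adj_some_some {t : ℕ} {k : Fin t → ℕ} (x y : Σ i : Fin t, Fin (k i)) :
    (starlike t k).Adj (some x) (some y) ↔
      x.1 = y.1 ∧ ((y.2 : ℕ) = x.2 + 1 ∨ (x.2 : ℕ) = y.2 + 1) := by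
  rw [starlike, SimpleGraph.fromRel_adj]
  constructor
  · rintro ⟨-, (⟨i', j', h, -⟩ | ⟨i', j', j'', h, h', h0⟩) |
      (⟨i', j', h, -⟩ | ⟨i', j', j'', h, h', h0⟩)⟩
    · cases h
    · cases h
      cases h'
      exact ⟨rfl, Or.inl h0⟩
    · cases h
    · cases h
      cases h'
      exact ⟨rfl, Or.inr h0⟩
  · obtain ⟨i, j⟩ := x
    obtain ⟨i', j'⟩ := y
    rintro ⟨h, h'⟩
    obtain rfl : i = i' := h
    simp only at h'
    refine ⟨?_, ?_⟩
    · intro h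
      cases h
      omega
    · rcases h' with h' | h'
      · exact Or.inl (Or.inr ⟨i, j, j', rfl, rfl, h'⟩)
      · exact Or.inr (Or.inr ⟨i, j', j, rfl, rfl, h'⟩)

theorem starlikeDist_eq_zero {t : ℕ} {k : Fin t → ℕ} (v u : Option (Σ i : Fin t, Fin (k i))) :
    starlikeDist v u = 0 ↔ u = v := by
  rcases v with _ | ⟨i, j⟩ <;> rcases u with _ | ⟨i', j'⟩
  · simp [starlikeDist]
  · simp [starlikeDist]
  · simp [starlikeDist]
  · by_cases h : i = i'
    · subst h
      simp only [starlikeDist, if_true, Option.some.injEq, Sigma.mk.injEq, heq_eq_eq, true_and,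
        Fin.ext_iff]
      omega
    · simp [starlikeDist, h, Ne.symm h]

theorem starlikeDist_le_of_adj {t : ℕ} {k : Fin t → ℕ} (v x y : Option (Σ i : Fin t, Fin (k i)))
    (h : (starlike t k).Adj x y) : starlikeDist v y ≤ starlikeDist v x + 1 := by
  rcases x with _ | ⟨i, j⟩ <;> rcases y with _ | ⟨i', j'⟩
  · exact absurd rfl h.ne
  · rw [starlike_adj_none_some] at h
    rcases v with _ | v <;> simp only [starlikeDist]
    · omega
    · split_ifs <;> omega
  · rw [SimpleGraph.adj_comm, starlike_adj_none_some] at h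
    rcases v with _ | v <;> simp only [starlikeDist]
    · omega
    · split_ifs <;> omega
  · rw [starlike_adj_some_some] at h
    obtain ⟨rfl, h⟩ := h
    rcases v with _ | v <;> simp only [starlikeDist] at h ⊢
    · omega
    · split_ifs <;> omega

theorem exists_adj_starlikeDist {t : ℕ} {k : Fin t → ℕ} (v u : Option (Σ i : Fin t, Fin (k i)))
    (h : starlikeDist v u ≠ 0) :
    ∃ w, (starlike t k).Adj w u ∧ starlikeDist v u = starlikeDist v w + 1 := by
  have inward : ∀ (i : Fin t) (j : Fin (k i)),
      (∀ l : Fin (k i), v = some ⟨i, l⟩ → (l : ℕ) < j) →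
      ∃ w, (starlike t k).Adj w (some ⟨i, j⟩) ∧
        starlikeDist v (some ⟨i, j⟩) = starlikeDist v w + 1 := by
    intro i j hv
    by_cases hj : (j : ℕ) = 0
    · refine ⟨none, (starlike_adj_none_some i j).mpr hj, ?_⟩
      rcases v with _ | ⟨i', l⟩
      · simp [starlikeDist, hj]
      · have hne : i' ≠ i := by
          rintro rfl
          have := hv l rfl
          omega
        simp [starlikeDist, hj, hne]
    · refine ⟨some ⟨i, ⟨j - 1, by omega⟩⟩, ?_, ?_⟩
      · rw [starlike_adj_some_some]
        exact ⟨rfl, Or.inl (by simp only; omega)⟩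
      · rcases v with _ | ⟨i', l⟩
        · simp only [starlikeDist]
          omega
        · by_cases hne : i' = i
          · subst hne
            have := hv l rfl
            simp only [starlikeDist, if_true]
            omega
          · simp only [starlikeDist, hne, if_false]
            omega
  rcases u with _ | ⟨i, j⟩
  · rcases v with _ | ⟨i, j⟩
    · simp [starlikeDist] at h
    · refine ⟨some ⟨i, ⟨0, j.pos⟩⟩, ?_, ?_⟩
      · rw [SimpleGraph.adj_comm, starlike_adj_none_some]
      · simp [starlikeDist]
  · by_cases hv : ∀ l : Fin (k i), v = some ⟨i, l⟩ → (l : ℕ) < j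
    · exact inward i j hv
    · push Not at hv
      obtain ⟨l, rfl, hl⟩ := hv
      simp only [starlikeDist, if_true] at h
      refine ⟨some ⟨i, ⟨j + 1, by omega⟩⟩, ?_, ?_⟩
      · rw [starlike_adj_some_some]
        exact ⟨rfl, Or.inr rfl⟩
      · simp only [starlikeDist, if_true]
        omega

theorem starlike_dist {t : ℕ} {k : Fin t → ℕ} (v u : Option (Σ i : Fin t, Fin (k i))) :
    (starlike t k).dist v u = starlikeDist v u :=
  SimpleGraph.dist_eq_of_potential _ v _ (starlikeDist_eq_zero v) (starlikeDist_le_of_adj v)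
    (exists_adj_starlikeDist v) u

theorem sum_range_dist_sub_of_le (p l : ℕ) (hl : l ≤ p + 1) :
    ∑ j ∈ Finset.range l, ((((p - j) + (j - p) : ℕ) : ℤ) - (j + 1)) = l * ((p : ℤ) - l) := by
  induction l with
  | zero => simp
  | succ l ih =>
    rw [Finset.sum_range_succ, ih (by omega), show (p - l) + (l - p) = p - l by omega,
      Nat.cast_sub (by omega)]
    push_cast
    ring

theorem sum_range_dist_sub (p l : ℕ) (hl : p + 1 ≤ l) :
    ∑ j ∈ Finset.range l, ((((p - j) + (j - p) : ℕ) : ℤ) - (j + 1)) = (p + 1) * ((p : ℤ) - l) := by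
  induction l, hl using Nat.le_induction with
  | base =>
    rw [sum_range_dist_sub_of_le p _ le_rfl]
    push_cast
    ring
  | succ l hl ih =>
    rw [Finset.sum_range_succ, ih, show (p - l) + (l - p) = l - p by omega,
      Nat.cast_sub (by omega)]
    push_cast
    ring

/-- The transmission of a vertex of a starlike tree relative to that of the center. -/
theorem transmission_starlike_some {t : ℕ} {k : Fin t → ℕ} (i : Fin t) (j : Fin (k i)) :
    (transmission (starlike t k) (some ⟨i, j⟩) : ℤ) = transmission (starlike t k) none
      + ((j : ℤ) + 1) * (∑ m, (k m : ℤ) + 1 - 2 * k i + j) := by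
  rw [← sub_eq_iff_eq_add']
  simp only [transmission, starlike_dist, Nat.cast_sum]
  rw [← Finset.sum_sub_distrib, Fintype.sum_option, Fintype.sum_sigma,
    ← Finset.add_sum_erase _ _ (Finset.mem_univ i)]
  have hsame : ∑ l : Fin (k i), ((starlikeDist (some ⟨i, j⟩) (some ⟨i, l⟩) : ℤ)
      - starlikeDist (k := k) none (some ⟨i, l⟩)) = ((j : ℤ) + 1) * ((j : ℤ) - k i) := by
    rw [← sum_range_dist_sub j (k i) j.isLt, ← Fin.sum_univ_eq_sum_range
      (fun l => ((((j - l) + (l - j) : ℕ) : ℤ) - (l + 1)))]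
    simp [starlikeDist]
  have hother : ∀ m ∈ Finset.univ.erase i, ∑ l : Fin (k m),
      ((starlikeDist (some ⟨i, j⟩) (some ⟨m, l⟩) : ℤ)
        - starlikeDist (k := k) none (some ⟨m, l⟩)) = k m * ((j : ℤ) + 1) := fun m hm => by
    have hne : i ≠ m := (Finset.ne_of_mem_erase hm).symm
    simp [starlikeDist, hne]
  rw [hsame, Finset.sum_congr rfl hother, ← Finset.sum_mul,
    ← Finset.add_sum_erase _ (fun m => (k m : ℤ)) (Finset.mem_univ i)]
  simp only [starlikeDist]
  push_cast
  ring

theorem two_mul_sum_range_add (a k : ℕ) :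
    2 * ∑ i ∈ Finset.range (k + 1), (a + i) = (2 * a + k) * (k + 1) := by
  induction k with
  | zero => simp
  | succ k ih =>
    rw [Finset.sum_range_succ, mul_add, ih]
    ring

/-- The excess over the center of the transmission of the vertex at distance `p` on the arm of
length `a + s`, in a tree with arms of lengths `a, …, a + k` and one arm as long as all these
together. -/
def shortGap (a k p s : ℕ) : ℤ :=
  p * ((2 * a + k) * (k + 1) - 2 * (a + s) + p)

theorem shortGap_mem_Dset {a k p s : ℕ} (hs : s ≤ k) (hps : p ≤ a + s) :
    shortGap a k p s ∈ Dset a k p := by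
  refine ⟨k + 1 - s, by omega, ?_, ?_⟩
  · split_ifs <;> omega
  · rw [shortGap, Nat.cast_sub (by omega)]
    push_cast
    ring

theorem le_shortGap {a k p s : ℕ} (hk : 1 ≤ k) (hp : 1 ≤ p) (hs : s ≤ k) :
    (k : ℤ) * (2 * a + k - 1) + 1 ≤ shortGap a k p s := by
  zify at *
  have h : (k : ℤ) * (2 * a + k - 1) + 1 ≤ (2 * a + k) * (k + 1) - 2 * (a + s) + p := by
    linarith
  have h0 : (0 : ℤ) ≤ k * (2 * a + k - 1) := mul_nonneg (by linarith) (by linarith)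
  rw [shortGap]
  nlinarith

theorem shortGap_lt {a k p q s r : ℕ} (hpq : p < q) (hps : p ≤ a + s) (hs : s ≤ k) (hr : r ≤ k) :
    shortGap a k p s < shortGap a k q r := by
  obtain ⟨u, rfl⟩ := Nat.exists_eq_add_of_le hs
  zify at *
  have hs0 : (0 : ℤ) ≤ s := by positivity
  have hu0 : (0 : ℤ) ≤ u := by positivity
  have ha0 : (0 : ℤ) ≤ a := by positivity
  have hp0 : (0 : ℤ) ≤ p := by positivity
  obtain ⟨M, hM⟩ : ∃ M : ℤ, M = 2 * a * (s + u) + ((s + u) ^ 2 - (s + u)) := ⟨_, rfl⟩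
  have hsq : (0 : ℤ) ≤ (s + u) ^ 2 - (s + u) := by
    rw [sub_nonneg]
    exact Int.le_self_sq _
  have hM0 : 0 ≤ M := by
    rw [hM]
    positivity
  have hq : ((p : ℤ) + 1) * (M + (p + 1)) ≤ shortGap a (s + u) q r := by
    rw [shortGap]
    refine mul_le_mul hpq ?_ (by linarith) (by linarith)
    push_cast
    linarith
  have hp : shortGap a (s + u) p s = p * (M + 2 * u + p) := by
    rw [shortGap, hM]
    push_cast
    ring
  have key : 2 * (p : ℤ) * u < M + 2 * p + 1 := by
    rcases le_total (p : ℤ) a with hpa | hpa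
    · have h1 := mul_le_mul_of_nonneg_right hpa hu0
      have h2 := mul_nonneg ha0 hs0
      linarith
    · obtain ⟨w, hw⟩ : ∃ w : ℤ, (p : ℤ) = a + w := ⟨p - a, by ring⟩
      have hw0 : 0 ≤ w := by linarith
      have hws : w ≤ s := by linarith
      have h1 := mul_nonneg ha0 hs0
      have h2 := mul_le_mul_of_nonneg_right hws hu0
      have h3 : (s : ℤ) ≤ s ^ 2 := Int.le_self_sq _
      have h4 : (u : ℤ) ≤ u ^ 2 := Int.le_self_sq _
      rw [hM, hw]
      linarith
  rw [hp]
  linarith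

theorem shortGap_inj {a k p q s r : ℕ} (hp : 1 ≤ p) (hps : p ≤ a + s)
    (hqr : q ≤ a + r) (hs : s ≤ k) (hr : r ≤ k) (h : shortGap a k p s = shortGap a k q r) :
    p = q ∧ s = r := by
  rcases lt_trichotomy p q with hpq | rfl | hpq
  · exact absurd h (shortGap_lt hpq hps hs hr).ne
  · have hp' : (p : ℤ) ≠ 0 := by exact_mod_cast (by omega : p ≠ 0)
    have := mul_left_cancel₀ hp' h
    omega
  · exact absurd h (shortGap_lt hpq hqr hr hs).ne'

/-- Let `T = T(a, a+1, …, a+k, (2a+k)(k+1)/2)`. If no element of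
`D = ⋃_{p=1}^{a+k} D_p` is a perfect square lying in the interval
`[k(2a+k-1)+1, ((2a+k)(k+1)/2)²]`, then `T` is transmission irregular. -/
theorem stmt_13 (a k : ℕ) (ha : 1 ≤ a) (hk : 1 ≤ k)
    (hsq : ∀ d ∈ ⋃ p ∈ Set.Icc 1 (a + k), Dset a k p,
      ¬ ((∃ m : ℤ, d = m ^ 2) ∧
        (k : ℤ) * (2 * (a : ℤ) + (k : ℤ) - 1) + 1 ≤ d ∧
        d ≤ (((2 * a + k) * (k + 1) / 2 : ℕ) : ℤ) ^ 2)) :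
    TransmissionIrregular (starlike (k + 2)
      (fun i => if i.val ≤ k then a + i.val else (2 * a + k) * (k + 1) / 2)) := by
  set arm : Fin (k + 2) → ℕ :=
    fun i => if i.val ≤ k then a + i.val else (2 * a + k) * (k + 1) / 2 with harm
  set L := (2 * a + k) * (k + 1) / 2 with hL
  have hL2 : 2 * L = (2 * a + k) * (k + 1) := by
    refine Nat.mul_div_cancel' ?_
    have h1 : (2 * a + k) * (k + 1) = 2 * (a * (k + 1)) + k * (k + 1) := by ring
    rw [h1]
    exact dvd_add (dvd_mul_right _ _) (Nat.even_mul_succ_self k).two_dvd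
  have hsum : ∑ i, arm i = 2 * L := by
    rw [Fin.sum_univ_castSucc]
    have h1 : ∀ i : Fin (k + 1), arm i.castSucc = a + i.val := fun i => by
      simp [harm, Nat.lt_succ_iff.mp i.isLt]
    have h2 : arm (Fin.last (k + 1)) = L := by simp [harm]
    have h3 : 2 * ∑ i : Fin (k + 1), (a + i.val) = (2 * a + k) * (k + 1) := by
      rw [Fin.sum_univ_eq_sum_range (fun i => a + i)]
      exact two_mul_sum_range_add a k
    simp only [h1, h2]
    omega
  have hLz : (2 : ℤ) * L = (2 * a + k) * (k + 1) := by exact_mod_cast hL2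
  have htr : ∀ (i : Fin (k + 2)) (j : Fin (arm i)),
      (transmission (starlike (k + 2) arm) (some ⟨i, j⟩) : ℤ)
        = transmission (starlike (k + 2) arm) none
          + ((j : ℤ) + 1) * ((2 * a + k) * (k + 1) + 1 - 2 * arm i + j) := fun i j => by
    rw [transmission_starlike_some, ← hLz, ← Nat.cast_sum, hsum]
    push_cast
    ring
  have hlong : ∀ (i : Fin (k + 2)) (j : Fin (arm i)), ¬ i.val ≤ k →
      (transmission (starlike (k + 2) arm) (some ⟨i, j⟩) : ℤ)
        = transmission (starlike (k + 2) arm) none + ((j : ℤ) + 1) ^ 2 := fun i j hi => by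
    have h1 : (arm i : ℤ) = L := by simp [harm, hi]
    rw [htr, h1, hLz]
    ring
  have hshort : ∀ (i : Fin (k + 2)) (j : Fin (arm i)), i.val ≤ k →
      (transmission (starlike (k + 2) arm) (some ⟨i, j⟩) : ℤ)
        = transmission (starlike (k + 2) arm) none
          + shortGap a k (j + 1) i ∧ (j : ℕ) + 1 ≤ a + i := fun i j hi => by
    have h1 : arm i = a + i := by simp [harm, hi]
    refine ⟨?_, h1 ▸ j.isLt⟩
    rw [htr, shortGap, show (arm i : ℤ) = a + i by exact_mod_cast h1]
    push_cast
    ring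
  have hmixed : ∀ (i i' : Fin (k + 2)) (j : Fin (arm i)) (j' : Fin (arm i')), i.val ≤ k →
      ¬ i'.val ≤ k → transmission (starlike (k + 2) arm) (some ⟨i, j⟩)
        ≠ transmission (starlike (k + 2) arm) (some ⟨i', j'⟩) := fun i i' j j' hi hi' h => by
    have h1 : arm i' = L := by simp [harm, hi']
    have hj' : (j' : ℕ) + 1 ≤ L := h1 ▸ j'.isLt
    obtain ⟨h2, h3⟩ := hshort i j hi
    have h4 := hlong i' j' hi'
    have h5 : shortGap a k (j + 1) i = ((j' : ℤ) + 1) ^ 2 := by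
      rw [h] at h2
      linarith
    refine hsq (shortGap a k (j + 1) i) ?_ ⟨⟨_, h5⟩, ?_, ?_⟩
    · simp only [Set.mem_iUnion]
      exact ⟨j + 1, ⟨by omega, by omega⟩, shortGap_mem_Dset hi h3⟩
    · exact le_shortGap hk (by omega) hi
    · rw [h5]
      have : ((j' : ℤ) + 1) ≤ L := by exact_mod_cast hj'
      gcongr
  have hcenter : ∀ (i : Fin (k + 2)) (j : Fin (arm i)),
      transmission (starlike (k + 2) arm) (some ⟨i, j⟩)
        ≠ transmission (starlike (k + 2) arm) none := fun i j h => by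
    by_cases hi : i.val ≤ k
    · have h2 := (hshort i j hi).1
      have h3 := le_shortGap (a := a) hk (show 1 ≤ (j : ℕ) + 1 by omega) hi
      have h4 : (0 : ℤ) ≤ k * (2 * a + k - 1) :=
        mul_nonneg (by positivity) (by have : (1 : ℤ) ≤ a := by exact_mod_cast ha
                                       have : (0 : ℤ) ≤ k := by positivity
                                       linarith)
      rw [h] at h2
      linarith
    · have h2 := hlong i j hi
      rw [h] at h2
      have : (0 : ℤ) < ((j : ℤ) + 1) ^ 2 := by positivity
      linarith
  rintro (_ | ⟨i, j⟩) (_ | ⟨i', j'⟩) h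
  · rfl
  · exact absurd h.symm (hcenter i' j')
  · exact absurd h (hcenter i j)
  by_cases hi : i.val ≤ k <;> by_cases hi' : i'.val ≤ k
  · obtain ⟨h1, h2⟩ := hshort i j hi
    obtain ⟨h3, h4⟩ := hshort i' j' hi'
    have h5 : shortGap a k (j + 1) i = shortGap a k (j' + 1) i' := by
      rw [h] at h1
      linarith
    obtain ⟨h6, h7⟩ := shortGap_inj (by omega) h2 h4 hi hi' h5
    obtain rfl := Fin.ext h7
    obtain rfl : j = j' := Fin.ext (by omega)
    rfl
  · exact absurd h (hmixed i i' j j' hi hi')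
  · exact absurd h.symm (hmixed i' i j' j hi' hi)
  · have h1 := hlong i j hi
    have h2 := hlong i' j' hi'
    obtain rfl : i = i' := Fin.ext (by omega)
    rw [h] at h1
    have h3 : ((j : ℤ) + 1) ^ 2 = ((j' : ℤ) + 1) ^ 2 := by linarith
    have h4 := (sq_eq_sq₀ (by positivity) (by positivity)).mp h3
    obtain rfl : j = j' := Fin.ext (by omega)
    rfl
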